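/- Let 𝒫 be the class of functions F : {0,1}^n → ℝ (of all arities n) all of whose Fourier coefficients F̂(y) = 2^{−n} Σ_{w∈{0,1}^n} (−1)^{|w∧y|} F(w) are nonnegative. Then 𝒫 is closed under pointwise addition, under pointwise products, under summation over a variable (i.e., if F ∈ 𝒫 has arity n+1 then H(x) = Σ_{t∈{0,1}} F(x,t) is in 𝒫), and under pointwise limits; moreover 𝒫 is a pps_ω-definable functional clone, i.e., ⟨𝒫⟩_ω = 𝒫. -/

import Mathlib

open scoped NNReal BigOperators

/-- Functions of arity `n` on the Boolean domain with values in `R`. -/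
abbrev FnOn (R : Type) (n : ℕ) : Type := (Fin n → Bool) → R

/-- Functions of all arities on the Boolean domain with values in `R`. -/
abbrev Fn (R : Type) : Type := Σ n : ℕ, FnOn R n

/-- The binary equality function: `EQ(x,x) = 1`, `EQ(x,y) = 0` for `x ≠ y`. -/
def EQfn (R : Type) [CommSemiring R] : Fn R :=
  ⟨2, fun x => if x 0 = x 1 then 1 else 0⟩

/-- `F` (of arity `n`) is representable by a pps-formula over `𝓕`: there are `m` bound
variables and `s` atomic formulas, the `j`-th atomic formula applying `G j ∈ 𝓕` to a
scope `σ j` of (possibly repeated) variables among the `n + m` variables; `F x` is the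
sum over all Boolean assignments of the bound variables of the product of the values of
the atomic formulas. -/
def PpsRep (R : Type) [CommSemiring R] (𝓕 : Set (Fn R)) {n : ℕ} (F : FnOn R n) : Prop :=
  ∃ (m s : ℕ) (G : Fin s → Fn R) (σ : (j : Fin s) → Fin (G j).1 → Fin (n + m)),
    (∀ j, G j ∈ 𝓕) ∧
    ∀ x : Fin n → Bool,
      F x = ∑ y : Fin m → Bool, ∏ j : Fin s, (G j).2 (fun i => Fin.append x y (σ j i))

/-- The functional clone `⟨𝓕⟩` generated by `𝓕`: all functions representable by a
pps-formula over `𝓕 ∪ {EQ}`. -/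
def Clone (R : Type) [CommSemiring R] (𝓕 : Set (Fn R)) : Set (Fn R) :=
  {F | PpsRep R (𝓕 ∪ {EQfn R}) F.2}

/-- The pps_ω-definable functional clone `⟨𝓕⟩_ω`: all functions `F` such that for some
finite `S ⊆ 𝓕 ∪ {EQ}` and every `ε > 0`, some function of the same arity representable
by a pps-formula over `S` is within `ε` of `F` in the sup norm. -/
def CloneOmega (R : Type) [CommSemiring R] [MetricSpace R] (𝓕 : Set (Fn R)) :
    Set (Fn R) :=
  {F | ∃ S : Set (Fn R), S ⊆ 𝓕 ∪ {EQfn R} ∧ S.Finite ∧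
    ∀ ε : ℝ, 0 < ε → ∃ Fhat : FnOn R F.1, PpsRep R S Fhat ∧
      ∀ x : Fin F.1 → Bool, dist (Fhat x) (F.2 x) < ε}

/-- The Fourier transform of `F : {0,1}^n → ℝ`:
`F̂(y) = 2⁻ⁿ Σ_w (−1)^{|w ∧ y|} F(w)`, where `|w ∧ y|` counts the coordinates where
both `w` and `y` are `1`. -/
noncomputable def bfourier {n : ℕ} (F : (Fin n → Bool) → ℝ) : (Fin n → Bool) → ℝ :=
  fun y => (2 ^ n : ℝ)⁻¹ *
    ∑ w : Fin n → Bool,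
      (-1 : ℝ) ^ (Finset.univ.filter fun i => w i = true ∧ y i = true).card * F w

/-- `𝒫`: the class of real-valued functions all of whose Fourier coefficients are
nonnegative. -/
def Pclass : Set (Fn ℝ) := {F | ∀ y, 0 ≤ bfourier F.2 y}

/-- The sign `(-1)^{a ∧ b}`. -/
def boolSign (a b : Bool) : ℝ := if a = true ∧ b = true then -1 else 1

/-- The character `w ↦ (-1)^{|w ∧ y|}` of the Boolean cube. -/
def cubeChar {n : ℕ} (y : Fin n → Bool) : FnOn ℝ n := fun w => ∏ i, boolSign (w i) (y i)

theorem cubeChar_apply {n : ℕ} (y w : Fin n → Bool) :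
    cubeChar y w = ∏ i, boolSign (w i) (y i) := rfl

theorem bfourier_eq_sum_cubeChar {n : ℕ} (F : FnOn ℝ n) (y : Fin n → Bool) :
    bfourier F y = (2 ^ n : ℝ)⁻¹ * ∑ w, cubeChar y w * F w := by
  simp [bfourier, cubeChar, boolSign, Finset.prod_ite]

theorem cubeChar_mul {n : ℕ} (y z : Fin n → Bool) :
    cubeChar y * cubeChar z = cubeChar fun i => xor (y i) (z i) := by
  ext w
  simp only [Pi.mul_apply, cubeChar, ← Finset.prod_mul_distrib]
  refine Finset.prod_congr rfl fun i _ => ?_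
  cases w i <;> cases y i <;> cases z i <;> simp [boolSign]

theorem sum_prod_bool_nonneg {n : ℕ} (f : Fin n → Bool → ℝ) (hf : ∀ i, 0 ≤ ∑ t, f i t) :
    0 ≤ ∑ w : Fin n → Bool, ∏ i, f i (w i) := by
  rw [← Fintype.prod_sum]
  exact Finset.prod_nonneg fun i _ => hf i

theorem sum_cubeChar_mul_cubeChar_nonneg {n : ℕ} (y z : Fin n → Bool) :
    0 ≤ ∑ w, cubeChar y w * cubeChar z w := by
  simp only [cubeChar, ← Finset.prod_mul_distrib]
  refine sum_prod_bool_nonneg (fun i t => boolSign t (y i) * boolSign t (z i)) fun i => ?_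
  cases y i <;> cases z i <;> norm_num [boolSign]

theorem sum_cubeChar_dual {n : ℕ} (v w : Fin n → Bool) :
    ∑ y, cubeChar y v * cubeChar y w = if v = w then 2 ^ n else 0 := by
  simp only [cubeChar, ← Finset.prod_mul_distrib]
  rw [← Fintype.prod_sum (fun i t => boolSign (v i) t * boolSign (w i) t)]
  have h : ∀ a b : Bool, ∑ t, boolSign a t * boolSign b t = if a = b then 2 else 0 := by
    intro a b
    cases a <;> cases b <;> norm_num [boolSign]
  simp only [h]
  split_ifs with hvw
  · simp [hvw]
  · obtain ⟨i, hi⟩ := Function.ne_iff.mp hvw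
    exact Finset.prod_eq_zero (Finset.mem_univ i) (if_neg hi)

theorem sum_bfourier_mul_cubeChar {n : ℕ} (F : FnOn ℝ n) (w : Fin n → Bool) :
    ∑ y, bfourier F y * cubeChar y w = F w := by
  simp only [bfourier_eq_sum_cubeChar, Finset.mul_sum, Finset.sum_mul]
  rw [Finset.sum_comm]
  calc _ = ∑ v, (2 ^ n : ℝ)⁻¹ * F v * ∑ y, cubeChar y v * cubeChar y w := by
        refine Finset.sum_congr rfl fun v _ => ?_
        rw [Finset.mul_sum]
        exact Finset.sum_congr rfl fun y _ => by ring
    _ = F w := by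
        simp only [sum_cubeChar_dual, mul_ite, mul_zero, Finset.sum_ite_eq', Finset.mem_univ,
          if_true]
        field_simp

/-- The cone of nonnegative combinations of characters. -/
def charCone (n : ℕ) : Submodule ℝ≥0 (FnOn ℝ n) := Submodule.span ℝ≥0 (Set.range cubeChar)

theorem cubeChar_mem_charCone {n : ℕ} (y : Fin n → Bool) : cubeChar y ∈ charCone n :=
  Submodule.subset_span ⟨y, rfl⟩

theorem bfourier_nonneg_of_mem_charCone {n : ℕ} {F : FnOn ℝ n} (hF : F ∈ charCone n)
    (y : Fin n → Bool) : 0 ≤ bfourier F y := by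
  rw [bfourier_eq_sum_cubeChar]
  refine mul_nonneg (by positivity) ?_
  induction hF using Submodule.span_induction with
  | mem f hf =>
    obtain ⟨z, rfl⟩ := hf
    exact sum_cubeChar_mul_cubeChar_nonneg y z
  | zero => simp
  | add f g _ _ hf hg =>
    simpa only [Pi.add_apply, mul_add, Finset.sum_add_distrib] using add_nonneg hf hg
  | smul c f _ hf =>
    simp only [Pi.smul_apply, NNReal.smul_def, smul_eq_mul, mul_left_comm _ (c : ℝ),
      ← Finset.mul_sum]
    exact mul_nonneg c.2 hf

theorem mem_Pclass_iff_mem_charCone {n : ℕ} {F : FnOn ℝ n} :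
    (⟨n, F⟩ : Fn ℝ) ∈ Pclass ↔ F ∈ charCone n := by
  refine ⟨fun h => ?_, bfourier_nonneg_of_mem_charCone⟩
  have hF : F = ∑ y, (⟨bfourier F y, h y⟩ : ℝ≥0) • cubeChar y := by
    ext w
    rw [Finset.sum_apply, ← sum_bfourier_mul_cubeChar F w]
    rfl
  rw [hF]
  exact Submodule.sum_mem _ fun y _ => Submodule.smul_mem _ _ (cubeChar_mem_charCone y)

theorem mul_mem_charCone {n : ℕ} {F G : FnOn ℝ n} (hF : F ∈ charCone n)
    (hG : G ∈ charCone n) : F * G ∈ charCone n := by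
  induction hF using Submodule.span_induction with
  | mem f hf =>
    obtain ⟨y, rfl⟩ := hf
    induction hG using Submodule.span_induction with
    | mem g hg =>
      obtain ⟨z, rfl⟩ := hg
      rw [cubeChar_mul]
      exact cubeChar_mem_charCone _
    | zero => simp
    | add f g _ _ hf hg => rw [mul_add]; exact Submodule.add_mem _ hf hg
    | smul c f _ hf => rw [mul_smul_comm]; exact Submodule.smul_mem _ _ hf
  | zero => simp
  | add f g _ _ hf hg => rw [add_mul]; exact Submodule.add_mem _ hf hg
  | smul c f _ hf => rw [smul_mul_assoc]; exact Submodule.smul_mem _ _ hf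

theorem one_mem_charCone (n : ℕ) : (1 : FnOn ℝ n) ∈ charCone n := by
  convert cubeChar_mem_charCone (fun _ : Fin n => false)
  ext w
  simp [cubeChar, boolSign]

theorem prod_mem_charCone {n : ℕ} {ι : Type*} (s : Finset ι) (f : ι → FnOn ℝ n)
    (hf : ∀ j ∈ s, f j ∈ charCone n) : ∏ j ∈ s, f j ∈ charCone n :=
  Finset.prod_induction f (· ∈ charCone n) (fun _ _ => mul_mem_charCone) (one_mem_charCone n) hf

theorem boolSign_coord_mem_charCone {n : ℕ} (k : Fin n) (b : Bool) :
    (fun w => boolSign (w k) b : FnOn ℝ n) ∈ charCone n := by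
  convert cubeChar_mem_charCone (fun i : Fin n => if i = k then b else false) with w
  rw [cubeChar_apply, Finset.prod_eq_single k]
  · simp
  · intro i _ hi
    simp [hi, boolSign]
  · simp

theorem comp_mem_charCone {a n : ℕ} (σ : Fin a → Fin n) {F : FnOn ℝ a} (hF : F ∈ charCone a) :
    (fun w => F (fun i => w (σ i)) : FnOn ℝ n) ∈ charCone n := by
  induction hF using Submodule.span_induction with
  | mem f hf =>
    obtain ⟨y, rfl⟩ := hf
    convert prod_mem_charCone Finset.univ (fun i w => boolSign (w (σ i)) (y i))
      (fun i _ => boolSign_coord_mem_charCone (σ i) (y i)) using 1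
    ext w
    simp [cubeChar]
  | zero => exact Submodule.zero_mem _
  | add f g _ _ hf hg => exact Submodule.add_mem _ hf hg
  | smul c f _ hf => exact Submodule.smul_mem _ c hf

theorem sum_append_mem_charCone {n m : ℕ} {F : FnOn ℝ (n + m)} (hF : F ∈ charCone (n + m)) :
    (fun x => ∑ y : Fin m → Bool, F (Fin.append x y) : FnOn ℝ n) ∈ charCone n := by
  induction hF using Submodule.span_induction with
  | mem f hf =>
    obtain ⟨z, rfl⟩ := hf
    have hc : 0 ≤ ∑ y : Fin m → Bool, ∏ j, boolSign (y j) (z (Fin.natAdd n j)) := by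
      refine sum_prod_bool_nonneg (fun j t => boolSign t (z (Fin.natAdd n j))) fun j => ?_
      cases z (Fin.natAdd n j) <;> norm_num [boolSign]
    have h : (fun x => ∑ y : Fin m → Bool, cubeChar z (Fin.append x y) : FnOn ℝ n) =
        (⟨_, hc⟩ : ℝ≥0) • cubeChar fun i => z (Fin.castAdd m i) := by
      ext x
      change _ = (∑ y : Fin m → Bool, ∏ j, boolSign (y j) (z (Fin.natAdd n j))) * cubeChar _ x
      simp only [cubeChar, Fin.prod_univ_add, Fin.append_left, Fin.append_right, Finset.sum_mul]
      exact Finset.sum_congr rfl fun y _ => mul_comm _ _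
    rw [h]
    exact Submodule.smul_mem _ _ (cubeChar_mem_charCone _)
  | zero =>
    simp only [Pi.zero_apply, Finset.sum_const_zero]
    exact Submodule.zero_mem _
  | add f g _ _ hf hg =>
    simp only [Pi.add_apply, Finset.sum_add_distrib]
    exact Submodule.add_mem _ hf hg
  | smul c f _ hf =>
    simp only [Pi.smul_apply, ← Finset.smul_sum]
    exact Submodule.smul_mem _ c hf

theorem EQfn_mem_Pclass : EQfn ℝ ∈ Pclass := by
  refine mem_Pclass_iff_mem_charCone.mpr ?_
  convert Submodule.smul_mem _ (2⁻¹ : ℝ≥0) (Submodule.add_mem _ (one_mem_charCone 2)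
    (cubeChar_mem_charCone (fun _ : Fin 2 => true))) using 1
  ext x
  simp only [cubeChar, Fin.prod_univ_two, Pi.smul_apply, Pi.add_apply, Pi.one_apply,
    NNReal.smul_def, smul_eq_mul, boolSign]
  cases x 0 <;> cases x 1 <;> norm_num

theorem mem_Pclass_of_ppsRep {S : Set (Fn ℝ)} (hS : S ⊆ Pclass) {n : ℕ} {F : FnOn ℝ n}
    (hF : PpsRep ℝ S F) : (⟨n, F⟩ : Fn ℝ) ∈ Pclass := by
  obtain ⟨m, s, G, σ, hG, hF⟩ := hF
  rw [mem_Pclass_iff_mem_charCone]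
  convert sum_append_mem_charCone (prod_mem_charCone Finset.univ
    (fun j (w : Fin (n + m) → Bool) => (G j).2 fun i => w (σ j i))
    fun j _ => comp_mem_charCone (σ j) (mem_Pclass_iff_mem_charCone.mp (hS (hG j)))) using 1
  ext x
  simp [hF]

theorem ppsRep_singleton (F : Fn ℝ) : PpsRep ℝ {F} F.2 :=
  ⟨0, 1, fun _ => F, fun _ => id, fun _ => rfl, fun x => by
    simp [Fin.append_right_nil, Subsingleton.elim _ (Fin.elim0 : Fin 0 → Bool)]⟩

theorem sum_snoc_mem_Pclass {n : ℕ} {F : FnOn ℝ (n + 1)} (hF : (⟨n + 1, F⟩ : Fn ℝ) ∈ Pclass) :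
    (⟨n, fun x => ∑ t : Bool, F (Fin.snoc x t)⟩ : Fn ℝ) ∈ Pclass := by
  rw [mem_Pclass_iff_mem_charCone] at hF ⊢
  convert sum_append_mem_charCone hF using 1
  ext x
  refine Fintype.sum_equiv (Equiv.funUnique (Fin 1) Bool).symm _ _ fun t => ?_
  rw [Fin.append_right_eq_snoc]
  rfl

theorem mem_Pclass_of_tendsto {n : ℕ} {F : ℕ → FnOn ℝ n} {L : FnOn ℝ n}
    (hF : ∀ k, (⟨n, F k⟩ : Fn ℝ) ∈ Pclass)
    (hL : ∀ x, Filter.Tendsto (fun k => F k x) Filter.atTop (nhds (L x))) :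
    (⟨n, L⟩ : Fn ℝ) ∈ Pclass := fun y =>
  ge_of_tendsto' ((tendsto_finsetSum _ fun w _ => (hL w).const_mul _).const_mul _)
    fun k => hF k y

theorem cloneOmega_Pclass : CloneOmega ℝ Pclass = Pclass := by
  ext F
  constructor
  · rintro ⟨S, hS, -, h⟩
    have hSP : S ⊆ Pclass :=
      hS.trans (Set.union_subset subset_rfl (Set.singleton_subset_iff.mpr EQfn_mem_Pclass))
    choose G hG hGF using fun k : ℕ => h (1 / ((k : ℝ) + 1)) Nat.one_div_pos_of_nat
    exact mem_Pclass_of_tendsto (fun k => mem_Pclass_of_ppsRep hSP (hG k)) fun x =>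
      tendsto_iff_dist_tendsto_zero.mpr (squeeze_zero (fun _ => dist_nonneg)
        (fun k => (hGF k x).le) tendsto_one_div_add_atTop_nhds_zero_nat)
  · intro hF
    exact ⟨{F}, Set.singleton_subset_iff.mpr (Or.inl hF), Set.finite_singleton F,
      fun ε hε => ⟨F.2, ppsRep_singleton F, fun x => by simpa using hε⟩⟩

/-- Lemma: `𝒫` is closed under pointwise addition, pointwise products, summation over a
variable, and pointwise limits; moreover `𝒫` is a pps_ω-definable functional clone,
i.e. `⟨𝒫⟩_ω = 𝒫`. -/
theorem Pclass_closed :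
    (∀ (n : ℕ) (F G : FnOn ℝ n), (⟨n, F⟩ : Fn ℝ) ∈ Pclass → (⟨n, G⟩ : Fn ℝ) ∈ Pclass →
      (⟨n, fun x => F x + G x⟩ : Fn ℝ) ∈ Pclass) ∧
    (∀ (n : ℕ) (F G : FnOn ℝ n), (⟨n, F⟩ : Fn ℝ) ∈ Pclass → (⟨n, G⟩ : Fn ℝ) ∈ Pclass →
      (⟨n, fun x => F x * G x⟩ : Fn ℝ) ∈ Pclass) ∧
    (∀ (n : ℕ) (F : FnOn ℝ (n + 1)), (⟨n + 1, F⟩ : Fn ℝ) ∈ Pclass →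
      (⟨n, fun x => ∑ t : Bool, F (Fin.snoc x t)⟩ : Fn ℝ) ∈ Pclass) ∧
    (∀ (n : ℕ) (F : ℕ → FnOn ℝ n) (L : FnOn ℝ n),
      (∀ k, (⟨n, F k⟩ : Fn ℝ) ∈ Pclass) →
      (∀ x, Filter.Tendsto (fun k => F k x) Filter.atTop (nhds (L x))) →
      (⟨n, L⟩ : Fn ℝ) ∈ Pclass) ∧
    CloneOmega ℝ Pclass = Pclass := by
  refine ⟨fun n F G hF hG => ?_, fun n F G hF hG => ?_, fun n F => sum_snoc_mem_Pclass,
    fun n F L => mem_Pclass_of_tendsto, cloneOmega_Pclass⟩ <;>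
    rw [mem_Pclass_iff_mem_charCone] at hF hG ⊢
  · exact Submodule.add_mem _ hF hG
  · exact mul_mem_charCone hF hG
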